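/- arXiv:2406.03942 — 5 statements merged into one kernel-verified Lean document; each statement's English description precedes it below -/
import Mathlib

section
/- Let S be a finite generalized quadrangle of order (s,t) with s,t ≥ 1, and let Ω be its set of flags. For every pair of flags (x,y) ∈ R_1: N_{11}(x,y)=t−1, N_{23}(x,y)=s, N_{35}(x,y)=st, N_{43}(x,y)=s(t−1), N_{55}(x,y)=st(t−1), and N_{12}(x,y)=N_{13}(x,y)=N_{15}(x,y)=N_{16}(x,y)=N_{24}(x,y)=N_{25}(x,y)=N_{33}(x,y)=N_{34}(x,y)=N_{36}(x,y)=N_{45}(x,y)=N_{46}(x,y)=N_{56}(x,y)=N_{66}(x,y)=0. -/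
section Defs

variable {P L : Type*}

/-- Two distinct points are collinear if some line is incident with both. -/
def Collin (I : P → L → Prop) (p q : P) : Prop :=
  p ≠ q ∧ ∃ N : L, I p N ∧ I q N

/-- A finite generalized quadrangle of order `(s,t)` with point set `P`,
line set `L` and incidence relation `I`. -/
structure IsGQ (s t : ℕ) (P L : Type*) (I : P → L → Prop) : Prop where
  nonemptyP : Nonempty P
  nonemptyL : Nonempty L
  finP : Finite P
  finL : Finite L
  lines_through : ∀ p : P, Nat.card {l : L // I p l} = t + 1
  points_on : ∀ l : L, Nat.card {p : P // I p l} = s + 1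
  unique_line : ∀ p q : P, p ≠ q → ∀ l m : L, I p l → I q l → I p m → I q m → l = m
  unique_point : ∀ l m : L, l ≠ m → ∀ p q : P, I p l → I p m → I q l → I q m → p = q
  gq3 : ∀ (p : P) (l : L), ¬ I p l →
    ∃! qM : P × L, I p qM.2 ∧ I qM.1 qM.2 ∧ I qM.1 l

/-- The set of flags (incident point–line pairs). -/
def GQFlag (I : P → L → Prop) : Type _ := {x : P × L // I x.1 x.2}

/-- The relations `R_0, …, R_7` on the set of flags.  For a flag `x = (p,L)` and
a flag `y = (q,M)`:
`R_0`: the diagonal; `R_1`: `p = q`, `L ≠ M`; `R_2`: `L = M`, `p ≠ q`;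
`R_3`: `p ≠ q`, `L ≠ M`, `q` incident with `L`;
`R_4`: `p ≠ q`, `L ≠ M`, `p` incident with `M`;
`R_5`: `p ≠ q` collinear on a line different from both `L` and `M`;
`R_6`: `L ≠ M` meet in a point `r` with `r ≠ p`, `r ≠ q`;
`R_7`: `L` and `M` have no common point and `p`, `q` are not collinear. -/
def Rrel (I : P → L → Prop) : ℕ → GQFlag I → GQFlag I → Prop
  | 0 => fun x y => x = y
  | 1 => fun x y => x.1.1 = y.1.1 ∧ x.1.2 ≠ y.1.2
  | 2 => fun x y => x.1.2 = y.1.2 ∧ x.1.1 ≠ y.1.1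
  | 3 => fun x y => x.1.1 ≠ y.1.1 ∧ x.1.2 ≠ y.1.2 ∧ I y.1.1 x.1.2
  | 4 => fun x y => x.1.1 ≠ y.1.1 ∧ x.1.2 ≠ y.1.2 ∧ I x.1.1 y.1.2
  | 5 => fun x y => x.1.1 ≠ y.1.1 ∧ ∃ N : L, I x.1.1 N ∧ I y.1.1 N ∧ N ≠ x.1.2 ∧ N ≠ y.1.2
  | 6 => fun x y => x.1.2 ≠ y.1.2 ∧ ∃ r : P, I r x.1.2 ∧ I r y.1.2 ∧ r ≠ x.1.1 ∧ r ≠ y.1.1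
  | 7 => fun x y => (∀ r : P, ¬ (I r x.1.2 ∧ I r y.1.2)) ∧ ¬ Collin I x.1.1 y.1.1
  | _ => fun _ _ => False

/-- `Ncount I i j x y` is the number of flags `z` with `(x,z) ∈ R_i` and `(z,y) ∈ R_j`. -/
noncomputable def Ncount (I : P → L → Prop) (i j : ℕ) (x y : GQFlag I) : ℕ :=
  Nat.card {z : GQFlag I // Rrel I i x z ∧ Rrel I j z y}

/-- The fused relations `S_0 = R_0`, `S_1 = R_1 ∪ R_2`, `S_2 = R_3 ∪ R_4`,
`S_3 = R_5 ∪ R_6`, `S_4 = R_7`. -/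
def Srel (I : P → L → Prop) : ℕ → GQFlag I → GQFlag I → Prop
  | 0 => fun x y => Rrel I 0 x y
  | 1 => fun x y => Rrel I 1 x y ∨ Rrel I 2 x y
  | 2 => fun x y => Rrel I 3 x y ∨ Rrel I 4 x y
  | 3 => fun x y => Rrel I 5 x y ∨ Rrel I 6 x y
  | 4 => fun x y => Rrel I 7 x y
  | _ => fun _ _ => False

/-- `Mcount I i j x y` is the number of flags `z` with `(x,z) ∈ S_i` and `(z,y) ∈ S_j`. -/
noncomputable def Mcount (I : P → L → Prop) (i j : ℕ) (x y : GQFlag I) : ℕ :=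
  Nat.card {z : GQFlag I // Srel I i x z ∧ Srel I j z y}

end Defs

/-- `C` is a maximal clique of the graph with adjacency relation `rel`. -/
def IsMaxClique {α : Type*} (rel : α → α → Prop) (C : Set α) : Prop :=
  (∀ y ∈ C, ∀ z ∈ C, y ≠ z → rel y z) ∧
  ∀ D : Set α, C ⊆ D → (∀ y ∈ D, ∀ z ∈ D, y ≠ z → rel y z) → D = C

/-- The point-clique through `x`: `{x} ∪ {z | (x,z) ∈ R_1}`. -/
def PC {α : Type*} (rel : ℕ → α → α → Prop) (x : α) : Set α :=
  insert x {z | rel 1 x z}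

/-- The line-clique through `x`: `{x} ∪ {z | (x,z) ∈ R_2}`. -/
def LC {α : Type*} (rel : ℕ → α → α → Prop) (x : α) : Set α :=
  insert x {z | rel 2 x z}

/-- Counting pairs by their first coordinate, when all fibres have the same size. -/
theorem card_subtype_prod_of_fibers {α β : Type*} [Finite α] [Finite β] {p : α → Prop}
    {q : α → β → Prop} {n : ℕ} (h : ∀ a, p a → Nat.card {b // q a b} = n) :
    Nat.card {z : α × β // p z.1 ∧ q z.1 z.2} = Nat.card {a // p a} * n := by
  let e : {z : α × β // p z.1 ∧ q z.1 z.2} ≃ Σ a : {a // p a}, {b // q a.1 b} :=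
    { toFun := fun z => ⟨⟨z.1.1, z.2.1⟩, ⟨z.1.2, z.2.2⟩⟩
      invFun := fun w => ⟨(w.1.1, w.2.1), w.1.2, w.2.2⟩
      left_inv := fun _ => rfl
      right_inv := fun _ => rfl }
  have : Fintype {a // p a} := Fintype.ofFinite _
  rw [Nat.card_congr e, Nat.card_sigma,
    Finset.sum_congr rfl fun a _ => h a.1 a.2]
  simp

/-- Removing one element from a finite subtype lowers its cardinality by one. -/
theorem card_subtype_and_ne {α : Type*} [Finite α] {p : α → Prop} {a : α} (ha : p a) :
    Nat.card {b // p b ∧ b ≠ a} = Nat.card {b // p b} - 1 :=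
  Set.ncard_sdiff_singleton_of_mem (s := {b | p b}) ha

/-- `N_{ij}` counts the point–line pairs satisfying any predicate that describes the flags
it is defined by. -/
theorem Ncount_eq_card_prod {P L : Type*} {I : P → L → Prop} {i j : ℕ} {x y : GQFlag I}
    {Q : P × L → Prop}
    (h : ∀ z : P × L, Q z ↔ ∃ hz : I z.1 z.2, Rrel I i x ⟨z, hz⟩ ∧ Rrel I j ⟨z, hz⟩ y) :
    Ncount I i j x y = Nat.card {z // Q z} :=
  Nat.card_congr
    { toFun := fun z => ⟨z.1.1, (h _).2 ⟨z.1.2, z.2⟩⟩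
      invFun := fun z => ⟨⟨z.1, ((h _).1 z.2).1⟩, ((h _).1 z.2).2⟩
      left_inv := fun _ => rfl
      right_inv := fun _ => rfl }

theorem Ncount_eq_zero {P L : Type*} {I : P → L → Prop} {i j : ℕ} {x y : GQFlag I}
    (h : ∀ (q : P) (N : L) (hz : I q N),
      Rrel I i x ⟨(q, N), hz⟩ → Rrel I j ⟨(q, N), hz⟩ y → False) :
    Ncount I i j x y = 0 :=
  have : IsEmpty {z : GQFlag I // Rrel I i x z ∧ Rrel I j z y} :=
    ⟨fun z => h z.1.1.1 z.1.1.2 z.1.2 z.2.1 z.2.2⟩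
  Nat.card_of_isEmpty

namespace IsGQ

variable {s t : ℕ} {P L : Type*} {I : P → L → Prop}

theorem card_lines_ne (h : IsGQ s t P L I) {p : P} {l : L} (hl : I p l) :
    Nat.card {m // I p m ∧ m ≠ l} = t := by
  have := h.finL
  rw [card_subtype_and_ne hl, h.lines_through, Nat.add_sub_cancel]

theorem card_lines_ne_ne (h : IsGQ s t P L I) {p : P} {l m : L} (hl : I p l) (hm : I p m)
    (hlm : l ≠ m) : Nat.card {k // (I p k ∧ k ≠ l) ∧ k ≠ m} = t - 1 := by
  have := h.finL
  rw [card_subtype_and_ne ⟨hm, hlm.symm⟩, h.card_lines_ne hl]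

theorem card_points_ne (h : IsGQ s t P L I) {p : P} {l : L} (hl : I p l) :
    Nat.card {q // I q l ∧ q ≠ p} = s := by
  have := h.finP
  rw [card_subtype_and_ne (p := fun q => I q l) hl, h.points_on, Nat.add_sub_cancel]

/-- A generalized quadrangle has no triangles. -/
theorem no_triangle (h : IsGQ s t P L I) {p q r : P} {k l m : L} (hpl : I p l) (hql : I q l)
    (hpm : I p m) (hrm : I r m) (hqk : I q k) (hrk : I r k) (hpk : ¬ I p k) :
    q = r ∧ l = m := by
  simpa using (h.gq3 p k hpk).unique (y₁ := (q, l)) (y₂ := (r, m)) ⟨hpl, hql, hqk⟩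
    ⟨hpm, hrm, hrk⟩

end IsGQ

/-- the intersection numbers `N_{ij}` on pairs in `R_1`. -/
theorem stmt_2 {s t : ℕ} (hs : 1 ≤ s) (ht : 1 ≤ t)
    {P L : Type*} (I : P → L → Prop) (hGQ : IsGQ s t P L I) :
    ∀ x y : GQFlag I, Rrel I 1 x y →
      Ncount I 1 1 x y = t - 1 ∧
      Ncount I 2 3 x y = s ∧
      Ncount I 3 5 x y = s * t ∧
      Ncount I 4 3 x y = s * (t - 1) ∧
      Ncount I 5 5 x y = s * t * (t - 1) ∧
      Ncount I 1 2 x y = 0 ∧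
      Ncount I 1 3 x y = 0 ∧
      Ncount I 1 5 x y = 0 ∧
      Ncount I 1 6 x y = 0 ∧
      Ncount I 2 4 x y = 0 ∧
      Ncount I 2 5 x y = 0 ∧
      Ncount I 3 3 x y = 0 ∧
      Ncount I 3 4 x y = 0 ∧
      Ncount I 3 6 x y = 0 ∧
      Ncount I 4 5 x y = 0 ∧
      Ncount I 4 6 x y = 0 ∧
      Ncount I 5 6 x y = 0 ∧
      Ncount I 6 6 x y = 0 := by
  rintro ⟨⟨p, l⟩, hl⟩ ⟨⟨p', m⟩, hm⟩ ⟨hpp, hlm⟩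
  dsimp only at hl hm hpp hlm
  subst hpp
  have finP := hGQ.finP
  have finL := hGQ.finL
  have uniq := hGQ.unique_line
  refine ⟨?_, ?_, ?_, ?_, ?_, ?_, ?_, ?_, ?_, ?_, ?_, ?_, ?_, ?_, ?_, ?_, ?_, ?_⟩
  · refine (Ncount_eq_card_prod (Q := fun z => z.1 = p ∧ (I p z.2 ∧ z.2 ≠ l) ∧ z.2 ≠ m)
      ?_).trans ?_
    · rintro ⟨q, n⟩
      simp only [Rrel]
      grind
    rw [card_subtype_prod_of_fibers (p := fun q => q = p)
        (q := fun _ n => (I p n ∧ n ≠ l) ∧ n ≠ m)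
        fun _ _ => hGQ.card_lines_ne_ne hl hm hlm]
    simp
  · refine (Ncount_eq_card_prod (Q := fun z => (I z.1 l ∧ z.1 ≠ p) ∧ z.2 = l)
      ?_).trans ?_
    · rintro ⟨q, n⟩
      simp only [Rrel]
      grind
    rw [card_subtype_prod_of_fibers (p := fun q => I q l ∧ q ≠ p) (q := fun _ n => n = l)
        (n := 1) (by simp), hGQ.card_points_ne hl, mul_one]
  · refine (Ncount_eq_card_prod (Q := fun z => (I z.1 l ∧ z.1 ≠ p) ∧ I z.1 z.2 ∧ z.2 ≠ l)
      ?_).trans ?_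
    · rintro ⟨q, n⟩
      simp only [Rrel]
      grind
    rw [card_subtype_prod_of_fibers (p := fun q => I q l ∧ q ≠ p)
        (q := fun q n => I q n ∧ n ≠ l) fun q hq => hGQ.card_lines_ne hq.1,
      hGQ.card_points_ne hl]
  · refine (Ncount_eq_card_prod
      (Q := fun z => ((I p z.2 ∧ z.2 ≠ l) ∧ z.2 ≠ m) ∧ I z.1 z.2 ∧ z.1 ≠ p)
      ?_).trans ?_
    · rintro ⟨q, n⟩
      simp only [Rrel]
      grind
    refine (Nat.card_congr ((Equiv.prodComm P L).subtypeEquiv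
      (q := fun z => ((I p z.1 ∧ z.1 ≠ l) ∧ z.1 ≠ m) ∧ I z.2 z.1 ∧ z.2 ≠ p)
      fun _ => Iff.rfl)).trans ?_
    rw [card_subtype_prod_of_fibers (p := fun n => (I p n ∧ n ≠ l) ∧ n ≠ m)
        (q := fun n q => I q n ∧ q ≠ p) fun n hn => hGQ.card_points_ne hn.1.1,
      hGQ.card_lines_ne_ne hl hm hlm, mul_comm]
  · have key : Nat.card {w : (L × P) × L // (((I p w.1.1 ∧ w.1.1 ≠ l) ∧ w.1.1 ≠ m) ∧
        I w.1.2 w.1.1 ∧ w.1.2 ≠ p) ∧ I w.1.2 w.2 ∧ w.2 ≠ w.1.1} = s * t * (t - 1) := by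
      rw [card_subtype_prod_of_fibers
          (p := fun w : L × P => ((I p w.1 ∧ w.1 ≠ l) ∧ w.1 ≠ m) ∧ I w.2 w.1 ∧ w.2 ≠ p)
          (q := fun w n => I w.2 n ∧ n ≠ w.1) fun w hw => hGQ.card_lines_ne hw.2.1,
        card_subtype_prod_of_fibers (p := fun n => (I p n ∧ n ≠ l) ∧ n ≠ m)
          (q := fun n q => I q n ∧ q ≠ p) fun n hn => hGQ.card_points_ne hn.1.1,
        hGQ.card_lines_ne_ne hl hm hlm]
      ring
    rw [← key]
    symm
    refine Nat.card_eq_of_bijective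
      (fun w => ⟨⟨(w.1.1.2, w.1.2), w.2.2.1⟩, ?_⟩) ⟨?_, ?_⟩
    · obtain ⟨⟨⟨k, q⟩, n⟩, ⟨⟨⟨hpk, hkl⟩, hkm⟩, hqk, hqp⟩, hqn, hnk⟩ := w
      exact ⟨⟨hqp.symm, k, hpk, hqk, hkl, hnk.symm⟩, hqp, k, hqk, hpk, hnk.symm, hkm⟩
    · rintro ⟨⟨⟨k, q⟩, n⟩, hw⟩ ⟨⟨⟨k', q'⟩, n'⟩, hw'⟩ heq
      have heq' : (q, n) = (q', n') := congrArg (fun z => z.1.1) heq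
      grind
    · rintro ⟨⟨⟨q, n⟩, hz⟩, ⟨hpq, k, hpk, hqk, hkl, hkn⟩, -, k', hqk', hpk', -, hkm⟩
      have hkk : k = k' := uniq p q hpq k k' hpk hqk hpk' hqk'
      subst hkk
      exact ⟨⟨((k, q), n), ⟨⟨⟨hpk, hkl⟩, hkm⟩, hqk, hpq.symm⟩, hz, hkn.symm⟩, rfl⟩
  all_goals
    have no_triangle := @IsGQ.no_triangle s t P L I hGQ
    apply Ncount_eq_zero
    intro q n hz
    simp only [Rrel]
    grind
end

section
/- Let S be a finite generalized quadrangle of order (s,t) with s,t ≥ 1, and let Ω be its set of flags. Then (Ω, {R_0,...,R_7}) is an association scheme of class 7: the relations R_0,...,R_7 partition Ω × Ω, R_0 is the diagonal, R_4 is the transpose of R_3 and every other R_i equals its own transpose, and for all i,j,k ∈ {0,...,7} and any two pairs (x,y), (x',y') ∈ R_k one has N_{ij}(x,y) = N_{ij}(x',y'). -/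
namespace GQFlag

variable {P L : Type*} {I : P → L → Prop}

theorem ext_components {x y : GQFlag I} (hp : x.1.1 = y.1.1) (hl : x.1.2 = y.1.2) : x = y :=
  Subtype.ext (Prod.ext hp hl)

/-- The flags with a given point correspond to the lines through that point. -/
def equivLines (p : P) : {z : GQFlag I // z.1.1 = p} ≃ {l : L // I p l} where
  toFun z := ⟨z.1.1.2, (congrArg (I · z.1.1.2) z.2).mp z.1.2⟩
  invFun l := ⟨⟨(p, l.1), l.2⟩, rfl⟩
  left_inv z := Subtype.ext (ext_components z.2.symm rfl)
  right_inv _ := rfl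

/-- The flags with a given line correspond to the points on that line. -/
def equivPoints (l : L) : {z : GQFlag I // z.1.2 = l} ≃ {p : P // I p l} where
  toFun z := ⟨z.1.1.1, (congrArg (I z.1.1.1) z.2).mp z.1.2⟩
  invFun p := ⟨⟨(p.1, l), p.2⟩, rfl⟩
  left_inv z := Subtype.ext (ext_components rfl z.2.symm)
  right_inv _ := rfl

end GQFlag

namespace IsGQ

variable {s t : ℕ} {P L : Type*} {I : P → L → Prop}

theorem finite_flag (h : IsGQ s t P L I) : Finite (GQFlag I) := by
  have := h.finP
  have := h.finL
  exact inferInstanceAs (Finite {x : P × L // I x.1 x.2})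

theorem exists_proj (h : IsGQ s t P L I) {p : P} {l : L} (hpl : ¬ I p l) :
    ∃ q m, I p m ∧ I q m ∧ I q l := by
  obtain ⟨⟨q, m⟩, hqm, -⟩ := h.gq3 p l hpl
  exact ⟨q, m, hqm⟩

theorem proj_unique (h : IsGQ s t P L I) {p : P} {l : L} (hpl : ¬ I p l) {q q' : P} {m m' : L}
    (h₁ : I p m) (h₂ : I q m) (h₃ : I q l) (h₁' : I p m') (h₂' : I q' m') (h₃' : I q' l) :
    q = q' ∧ m = m' :=
  Prod.ext_iff.mp ((h.gq3 p l hpl).unique (y₁ := (q, m)) (y₂ := (q', m'))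
    ⟨h₁, h₂, h₃⟩ ⟨h₁', h₂', h₃'⟩)

/-- The relations are pairwise disjoint. -/
theorem rrel_index_unique (h : IsGQ s t P L I) {i j : ℕ} {x y : GQFlag I}
    (hi : Rrel I i x y) (hj : Rrel I j x y) : i = j := by
  obtain ⟨⟨p, l⟩, hpl⟩ := x
  obtain ⟨⟨q, m⟩, hqm⟩ := y
  have hline := h.unique_line
  have hproj := fun h₀ r k r' k' => h.proj_unique (p := p) (l := m) h₀ (q := r) (m := k)
    (q' := r') (m' := k')
  have hcol : Collin I p q ↔ p ≠ q ∧ ∃ N : L, I p N ∧ I q N := Iff.rfl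
  match i, j with
  | 0, 0 | 1, 1 | 2, 2 | 3, 3 | 4, 4 | 5, 5 | 6, 6 | 7, 7 => rfl
  | 0, 1 | 0, 2 | 0, 3 | 0, 4 | 0, 5 | 0, 6 | 0, 7
  | 1, 0 | 2, 0 | 3, 0 | 4, 0 | 5, 0 | 6, 0 | 7, 0 
  | 1, 2 | 1, 3 | 1, 4 | 1, 5 | 1, 6 | 1, 7 | 2, 1 | 2, 3 | 2, 4 | 2, 5 | 2, 6 | 2, 7
  | 3, 1 | 3, 2 | 3, 4 | 3, 5 | 3, 6 | 3, 7 | 4, 1 | 4, 2 | 4, 3 | 4, 5 | 4, 6 | 4, 7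
  | 5, 1 | 5, 2 | 5, 3 | 5, 4 | 5, 6 | 5, 7 | 6, 1 | 6, 2 | 6, 3 | 6, 4 | 6, 5 | 6, 7
  | 7, 1 | 7, 2 | 7, 3 | 7, 4 | 7, 5 | 7, 6 =>
    simp only [Rrel] at hi hj
    grind
  | _ + 8, _ => exact hi.elim
  | _, _ + 8 => exact hj.elim

/-- The relations cover all pairs of flags. -/
theorem exists_rrel (x y : GQFlag I) : ∃ i < 8, Rrel I i x y := by
  by_contra! hne
  have h0 := hne 0 (by omega)
  have h1 := hne 1 (by omega)
  have h2 := hne 2 (by omega)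
  have h3 := hne 3 (by omega)
  have h4 := hne 4 (by omega)
  have h5 := hne 5 (by omega)
  have h6 := hne 6 (by omega)
  have h7 := hne 7 (by omega)
  obtain ⟨⟨p, l⟩, hpl⟩ := x
  obtain ⟨⟨q, m⟩, hqm⟩ := y
  simp only [Rrel, Collin] at *
  grind

open scoped Classical in
/-- The adjacency matrix of the `i`-th relation. -/
noncomputable def adj (I : P → L → Prop) (i : ℕ) : Matrix (GQFlag I) (GQFlag I) ℤ :=
  fun x y => if Rrel I i x y then 1 else 0

theorem adj_zero [DecidableEq (GQFlag I)] : adj I 0 = 1 := by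
  ext x y
  simp [adj, Rrel, Matrix.one_apply]

theorem adj_of_eight_le (i : ℕ) : adj I (i + 8) = 0 := by
  ext x y
  simp [adj, Rrel]

/-- The `ℤ`-module spanned by the adjacency matrices. -/
noncomputable def bose (I : P → L → Prop) : Submodule ℤ (Matrix (GQFlag I) (GQFlag I) ℤ) :=
  Submodule.span ℤ (Set.range (adj I))

theorem adj_mem_bose (i : ℕ) : adj I i ∈ bose I :=
  Submodule.subset_span ⟨i, rfl⟩

section Algebra

variable [Fintype (GQFlag I)]

theorem adj_mul_adj_apply (i j : ℕ) (x y : GQFlag I) :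
    (adj I i * adj I j) x y = Ncount I i j x y := by
  classical
  simp [Matrix.mul_apply, adj, Ncount, ← ite_and, Fintype.card_subtype, and_comm]

theorem adj_mul_adj_eq {i j k : ℕ}
    (hmem : ∀ x z y : GQFlag I, Rrel I i x z → Rrel I j z y → Rrel I k x y)
    (hex : ∀ x y : GQFlag I, Rrel I k x y → ∃ z, Rrel I i x z ∧ Rrel I j z y)
    (huniq : ∀ x z z' y : GQFlag I, Rrel I i x z → Rrel I j z y → Rrel I i x z' →
      Rrel I j z' y → z = z') :
    adj I i * adj I j = adj I k := by
  ext x y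
  rw [adj_mul_adj_apply, adj, Ncount]
  split_ifs with hk
  · obtain ⟨z, hz⟩ := hex x y hk
    have : Unique {z // Rrel I i x z ∧ Rrel I j z y} :=
      ⟨⟨z, hz⟩, fun w => Subtype.ext (huniq x _ _ y w.2.1 w.2.2 hz.1 hz.2)⟩
    simp
  · have : IsEmpty {z // Rrel I i x z ∧ Rrel I j z y} :=
      ⟨fun z => hk (hmem x z y z.2.1 z.2.2)⟩
    simp

theorem adj_one_mul_adj_two (h : IsGQ s t P L I) : adj I 1 * adj I 2 = adj I 4 := by
  have hline := h.unique_line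
  apply adj_mul_adj_eq
  · rintro ⟨⟨p, l⟩, hpl⟩ ⟨⟨r, k⟩, hrk⟩ ⟨⟨q, m⟩, hqm⟩
    simp only [Rrel]
    grind
  · rintro ⟨⟨p, l⟩, hpl⟩ ⟨⟨q, m⟩, hqm⟩ ⟨h₁, h₂, h₃⟩
    exact ⟨⟨(p, m), h₃⟩, ⟨rfl, h₂⟩, rfl, h₁⟩
  · rintro x z z' y h₁ h₂ h₃ h₄
    exact GQFlag.ext_components (h₁.1.symm.trans h₃.1) (h₂.1.trans h₄.1.symm)

theorem adj_two_mul_adj_one (h : IsGQ s t P L I) : adj I 2 * adj I 1 = adj I 3 := by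
  have hline := h.unique_line
  apply adj_mul_adj_eq
  · rintro ⟨⟨p, l⟩, hpl⟩ ⟨⟨r, k⟩, hrk⟩ ⟨⟨q, m⟩, hqm⟩
    simp only [Rrel]
    grind
  · rintro ⟨⟨p, l⟩, hpl⟩ ⟨⟨q, m⟩, hqm⟩ ⟨h₁, h₂, h₃⟩
    exact ⟨⟨(q, l), h₃⟩, ⟨rfl, h₁⟩, rfl, h₂⟩
  · rintro x z z' y h₁ h₂ h₃ h₄
    exact GQFlag.ext_components (h₂.1.trans h₄.1.symm) (h₁.1.symm.trans h₃.1)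

theorem adj_one_mul_adj_three (h : IsGQ s t P L I) : adj I 1 * adj I 3 = adj I 5 := by
  have hline := h.unique_line
  apply adj_mul_adj_eq
  · rintro ⟨⟨p, l⟩, hpl⟩ ⟨⟨r, k⟩, hrk⟩ ⟨⟨q, m⟩, hqm⟩
    simp only [Rrel]
    grind
  · rintro ⟨⟨p, l⟩, hpl⟩ ⟨⟨q, m⟩, hqm⟩ ⟨h₁, k, h₂, h₃, h₄, h₅⟩
    exact ⟨⟨(p, k), h₂⟩, ⟨rfl, h₄.symm⟩, h₁, h₅, h₃⟩
  · rintro ⟨⟨p, l⟩, hpl⟩ ⟨⟨r, k⟩, hrk⟩ ⟨⟨r', k'⟩, hrk'⟩ ⟨⟨q, m⟩, hqm⟩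
    simp only [Rrel]
    grind

theorem adj_two_mul_adj_four (h : IsGQ s t P L I) : adj I 2 * adj I 4 = adj I 6 := by
  have hpoint := h.unique_point
  apply adj_mul_adj_eq
  · rintro ⟨⟨p, l⟩, hpl⟩ ⟨⟨r, k⟩, hrk⟩ ⟨⟨q, m⟩, hqm⟩
    simp only [Rrel]
    grind
  · rintro ⟨⟨p, l⟩, hpl⟩ ⟨⟨q, m⟩, hqm⟩ ⟨h₁, r, h₂, h₃, h₄, h₅⟩
    exact ⟨⟨(r, l), h₂⟩, ⟨rfl, h₄.symm⟩, h₅, h₁, h₃⟩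
  · rintro ⟨⟨p, l⟩, hpl⟩ ⟨⟨r, k⟩, hrk⟩ ⟨⟨r', k'⟩, hrk'⟩ ⟨⟨q, m⟩, hqm⟩
    simp only [Rrel]
    grind

theorem adj_one_mul_adj_six (h : IsGQ s t P L I) : adj I 1 * adj I 6 = adj I 7 := by
  have hline := h.unique_line
  apply adj_mul_adj_eq
  · rintro ⟨⟨p, l⟩, hpl⟩ ⟨⟨p', k⟩, hpk⟩ ⟨⟨q, m⟩, hqm⟩ ⟨hp, hlk⟩ ⟨hkm, r, hrk, hrm, hrp, hrq⟩
    dsimp only at *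
    subst hp
    have hpm : ¬ I p m := fun hpm => hkm (hline r p hrp k m hrk hpk hrm hpm)
    exact ⟨fun r' hr' => hlk (h.proj_unique hpm hpl hr'.1 hr'.2 hpk hrk hrm).2,
      fun ⟨_, n, hpn, hqn⟩ => hrq (h.proj_unique hpm hpk hrk hrm hpn hqn hqm).1⟩
  · rintro ⟨⟨p, l⟩, hpl⟩ ⟨⟨q, m⟩, hqm⟩ ⟨h₁, h₂⟩
    dsimp only at *
    have hpm : ¬ I p m := fun hpm => h₁ p ⟨hpl, hpm⟩
    obtain ⟨r, k, hpk, hrk, hrm⟩ := h.exists_proj hpm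
    refine ⟨⟨(p, k), hpk⟩, ⟨rfl, ?_⟩, ?_, r, hrk, hrm, ?_, ?_⟩ <;> dsimp only <;> rintro rfl
    · exact h₁ r ⟨hrk, hrm⟩
    · exact hpm hpk
    · exact hpm hrm
    · exact h₂ ⟨fun e => hpm (e ▸ hrm), k, hpk, hrk⟩
  · rintro ⟨⟨p, l⟩, hpl⟩ ⟨⟨r, k⟩, hrk⟩ ⟨⟨r', k'⟩, hrk'⟩ ⟨⟨q, m⟩, hqm⟩
    have hproj := fun h₀ r k r' k' => h.proj_unique (p := p) (l := m) h₀ (q := r) (m := k)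
      (q' := r') (m' := k')
    simp only [Rrel]
    grind

theorem adj_two_mul_adj_five (h : IsGQ s t P L I) : adj I 2 * adj I 5 = adj I 7 := by
  have hline := h.unique_line
  apply adj_mul_adj_eq
  · rintro ⟨⟨p, l⟩, hpl⟩ ⟨⟨r, l'⟩, hrl⟩ ⟨⟨q, m⟩, hqm⟩ ⟨hl, hpr⟩ ⟨hrq, k, hrk, hqk, hkl, hkm⟩
    dsimp only at *
    subst hl
    have hql : ¬ I q l := fun hql => hkl (hline r q hrq k l hrk hqk hrl hql)
    exact ⟨fun r' hr' => hkm (h.proj_unique hql hqk hrk hrl hqm hr'.2 hr'.1).2,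
      fun ⟨_, n, hpn, hqn⟩ => hpr (h.proj_unique hql hqn hpn hpl hqk hrk hrl).1⟩
  · rintro ⟨⟨p, l⟩, hpl⟩ ⟨⟨q, m⟩, hqm⟩ ⟨h₁, h₂⟩
    dsimp only at *
    have hql : ¬ I q l := fun hql => h₁ q ⟨hql, hqm⟩
    obtain ⟨r, k, hqk, hrk, hrl⟩ := h.exists_proj hql
    refine ⟨⟨(r, l), hrl⟩, ⟨rfl, ?_⟩, ?_, k, hrk, hqk, ?_, ?_⟩ <;> dsimp only <;> rintro rfl
    · exact h₂ ⟨fun e => hql (e ▸ hpl), k, hrk, hqk⟩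
    · exact hql hrl
    · exact hql hqk
    · exact h₁ r ⟨hrl, hrk⟩
  · rintro ⟨⟨p, l⟩, hpl⟩ ⟨⟨r, k⟩, hrk⟩ ⟨⟨r', k'⟩, hrk'⟩ ⟨⟨q, m⟩, hqm⟩
    have hproj := fun h₀ r k r' k' => h.proj_unique (p := q) (l := l) h₀ (q := r) (m := k)
      (q' := r') (m' := k')
    simp only [Rrel]
    grind

variable [DecidableEq (GQFlag I)]

/-- If `1 + A` is the indicator matrix of the kernel of a map whose nonempty fibres all have
`n + 1` elements, then `A` satisfies a quadratic equation. -/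
theorem mul_self_of_fibres {Ω β : Type*} [Fintype Ω] [DecidableEq Ω] [DecidableEq β]
    (f : Ω → β) {n : ℕ} (hf : ∀ x, Nat.card {z // f z = f x} = n + 1) {A : Matrix Ω Ω ℤ}
    (hA : ∀ x y, (1 + A) x y = if f x = f y then 1 else 0) :
    A * A = (n : ℤ) • 1 + (n - 1 : ℤ) • A := by
  have key : (1 + A) * (1 + A) = (n + 1 : ℤ) • (1 + A) := by
    ext x y
    simp only [Matrix.mul_apply, Matrix.smul_apply, hA]
    by_cases hxy : f x = f y
    · have := hf x
      rw [Nat.card_eq_fintype_card, Fintype.card_subtype] at this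
      simp only [← hxy, eq_comm (a := f x), ite_zero_mul_ite_zero, and_self, mul_one,
        Finset.sum_boole, this]
      simp
    · have : ∀ z, ¬ (f x = f z ∧ f z = f y) := fun z hz => hxy (hz.1.trans hz.2)
      simp only [ite_zero_mul_ite_zero, this, hxy, if_false, Finset.sum_const_zero, smul_zero]
  have expand : A * A = (1 + A) * (1 + A) - 1 - 2 • A := by noncomm_ring
  rw [expand, key]
  module

theorem adj_one_mul_self (h : IsGQ s t P L I) :
    adj I 1 * adj I 1 = (t : ℤ) • 1 + (t - 1 : ℤ) • adj I 1 := by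
  classical
  refine mul_self_of_fibres (fun x => x.1.1)
    (fun x => (Nat.card_congr (GQFlag.equivLines x.1.1)).trans (h.lines_through _)) ?_
  intro x y
  rw [← adj_zero]
  have := @GQFlag.ext_components _ _ _ x y
  simp only [Matrix.add_apply, adj, Rrel]
  grind

theorem adj_two_mul_self (h : IsGQ s t P L I) :
    adj I 2 * adj I 2 = (s : ℤ) • 1 + (s - 1 : ℤ) • adj I 2 := by
  classical
  refine mul_self_of_fibres (fun x => x.1.2)
    (fun x => (Nat.card_congr (GQFlag.equivPoints x.1.2)).trans (h.points_on _)) ?_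
  intro x y
  rw [← adj_zero]
  have := @GQFlag.ext_components _ _ _ x y
  simp only [Matrix.add_apply, adj, Rrel]
  grind

theorem mul_mul_mem_bose {A : Matrix (GQFlag I) (GQFlag I) ℤ} {c d : ℤ} {i j : ℕ}
    (hA : A * A = c • 1 + d • A) (hij : A * adj I i = adj I j) :
    A * adj I i ∈ bose I ∧ A * adj I j ∈ bose I := by
  refine ⟨hij ▸ adj_mem_bose j, ?_⟩
  rw [← hij, ← mul_assoc, hA, add_mul, smul_mul_assoc, smul_mul_assoc, one_mul, hij]
  exact add_mem (Submodule.smul_mem _ _ (adj_mem_bose i)) (Submodule.smul_mem _ _ (adj_mem_bose j))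

theorem mul_mem_bose_of_forall {A M : Matrix (GQFlag I) (GQFlag I) ℤ}
    (hA : ∀ i, A * adj I i ∈ bose I) (hM : M ∈ bose I) : A * M ∈ bose I := by
  have : bose I ≤ (bose I).comap (LinearMap.mulLeft ℤ A) :=
    Submodule.span_le.mpr (Set.range_subset_iff.mpr hA)
  exact this hM

theorem adj_one_mul_mem_bose (h : IsGQ s t P L I) {M : Matrix (GQFlag I) (GQFlag I) ℤ}
    (hM : M ∈ bose I) : adj I 1 * M ∈ bose I := by
  refine mul_mem_bose_of_forall (fun i => ?_) hM
  have h01 := mul_mul_mem_bose h.adj_one_mul_self (i := 0) (j := 1) (by rw [adj_zero, mul_one])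
  have h24 := mul_mul_mem_bose h.adj_one_mul_self h.adj_one_mul_adj_two
  have h35 := mul_mul_mem_bose h.adj_one_mul_self h.adj_one_mul_adj_three
  have h67 := mul_mul_mem_bose h.adj_one_mul_self h.adj_one_mul_adj_six
  match i with
  | 0 => exact h01.1
  | 1 => exact h01.2
  | 2 => exact h24.1
  | 3 => exact h35.1
  | 4 => exact h24.2
  | 5 => exact h35.2
  | 6 => exact h67.1
  | 7 => exact h67.2
  | i + 8 => simp [adj_of_eight_le]

theorem adj_two_mul_mem_bose (h : IsGQ s t P L I) {M : Matrix (GQFlag I) (GQFlag I) ℤ}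
    (hM : M ∈ bose I) : adj I 2 * M ∈ bose I := by
  refine mul_mem_bose_of_forall (fun i => ?_) hM
  have h02 := mul_mul_mem_bose h.adj_two_mul_self (i := 0) (j := 2) (by rw [adj_zero, mul_one])
  have h13 := mul_mul_mem_bose h.adj_two_mul_self h.adj_two_mul_adj_one
  have h46 := mul_mul_mem_bose h.adj_two_mul_self h.adj_two_mul_adj_four
  have h57 := mul_mul_mem_bose h.adj_two_mul_self h.adj_two_mul_adj_five
  match i with
  | 0 => exact h02.1
  | 1 => exact h13.1
  | 2 => exact h02.2
  | 3 => exact h13.2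
  | 4 => exact h46.1
  | 5 => exact h57.1
  | 6 => exact h46.2
  | 7 => exact h57.2
  | i + 8 => simp [adj_of_eight_le]

theorem adj_mul_mem_bose (h : IsGQ s t P L I) (i : ℕ) {M : Matrix (GQFlag I) (GQFlag I) ℤ}
    (hM : M ∈ bose I) : adj I i * M ∈ bose I := by
  have one {M} (hM : M ∈ bose I) := h.adj_one_mul_mem_bose hM
  have two {M} (hM : M ∈ bose I) := h.adj_two_mul_mem_bose hM
  have three {M} (hM : M ∈ bose I) : adj I 3 * M ∈ bose I := by
    rw [← h.adj_two_mul_adj_one, mul_assoc]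
    exact two (one hM)
  have four {M} (hM : M ∈ bose I) : adj I 4 * M ∈ bose I := by
    rw [← h.adj_one_mul_adj_two, mul_assoc]
    exact one (two hM)
  have six {M} (hM : M ∈ bose I) : adj I 6 * M ∈ bose I := by
    rw [← h.adj_two_mul_adj_four, mul_assoc]
    exact two (four hM)
  match i with
  | 0 => rwa [adj_zero, one_mul]
  | 1 => exact one hM
  | 2 => exact two hM
  | 3 => exact three hM
  | 4 => exact four hM
  | 5 =>
    rw [← h.adj_one_mul_adj_three, mul_assoc]
    exact one (three hM)
  | 6 => exact six hM
  | 7 =>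
    rw [← h.adj_one_mul_adj_six, mul_assoc]
    exact one (six hM)
  | i + 8 => simp [adj_of_eight_le]

end Algebra

theorem apply_eq_of_mem_bose (h : IsGQ s t P L I) {M : Matrix (GQFlag I) (GQFlag I) ℤ}
    (hM : M ∈ bose I) {k : ℕ} {x y x' y' : GQFlag I} (hxy : Rrel I k x y)
    (hxy' : Rrel I k x' y') : M x y = M x' y' := by
  induction hM using Submodule.span_induction with
  | mem M hM =>
    obtain ⟨i, rfl⟩ := hM
    have hiff : Rrel I i x y ↔ Rrel I i x' y' :=
      ⟨fun hi => h.rrel_index_unique hi hxy ▸ hxy', fun hi => h.rrel_index_unique hi hxy' ▸ hxy⟩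
    classical
    exact if_congr hiff rfl rfl
  | zero => rfl
  | add M N _ _ hM hN => simp [hM, hN]
  | smul c M _ hM => simp [hM]

theorem ncount_eq (h : IsGQ s t P L I) (i j : ℕ) {k : ℕ} {x y x' y' : GQFlag I}
    (hxy : Rrel I k x y) (hxy' : Rrel I k x' y') : Ncount I i j x y = Ncount I i j x' y' := by
  classical
  have := h.finite_flag
  have := Fintype.ofFinite (GQFlag I)
  have key := h.apply_eq_of_mem_bose (h.adj_mul_mem_bose i (adj_mem_bose j)) hxy hxy'
  rw [adj_mul_adj_apply, adj_mul_adj_apply] at key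
  exact_mod_cast key

end IsGQ

theorem rrel_four_iff {P L : Type*} {I : P → L → Prop} (x y : GQFlag I) :
    Rrel I 4 x y ↔ Rrel I 3 y x := by
  simp only [Rrel, ne_comm]

theorem rrel_comm {P L : Type*} {I : P → L → Prop} {i : ℕ} (h3 : i ≠ 3) (h4 : i ≠ 4)
    (x y : GQFlag I) : Rrel I i x y ↔ Rrel I i y x := by
  match i with
  | 0 | 1 | 2 | 5 | 6 | 7 =>
    simp only [Rrel, Collin]
    grind
  | 3 => exact absurd rfl h3
  | 4 => exact absurd rfl h4
  | _ + 8 => exact Iff.rfl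

/-- `(Ω, {R_0,…,R_7})` is an association scheme of class 7. -/
theorem stmt_5 {s t : ℕ} (hs : 1 ≤ s) (ht : 1 ≤ t)
    {P L : Type*} (I : P → L → Prop) (hGQ : IsGQ s t P L I) :
    (∀ x y : GQFlag I, ∃! i : ℕ, i < 8 ∧ Rrel I i x y) ∧
    (∀ x y : GQFlag I, Rrel I 0 x y ↔ x = y) ∧
    (∀ x y : GQFlag I, Rrel I 4 x y ↔ Rrel I 3 y x) ∧
    (∀ i : ℕ, i < 8 → i ≠ 3 → i ≠ 4 → ∀ x y : GQFlag I, Rrel I i x y ↔ Rrel I i y x) ∧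
    (∀ i j k : ℕ, i < 8 → j < 8 → k < 8 → ∀ x y x' y' : GQFlag I,
      Rrel I k x y → Rrel I k x' y' → Ncount I i j x y = Ncount I i j x' y') := by
  refine ⟨fun x y => ?_, fun x y => Iff.rfl, rrel_four_iff,
    fun i _ h3 h4 x y => rrel_comm h3 h4 x y,
    fun i j k _ _ _ x y x' y' hxy hxy' => hGQ.ncount_eq i j hxy hxy'⟩
  obtain ⟨i, hi, hxy⟩ := IsGQ.exists_rrel x y
  exact ⟨i, ⟨hi, hxy⟩, fun j hj => hGQ.rrel_index_unique hj.2 hxy⟩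
end

section
/- Let Ω' with relations R'_0,...,R'_7 be an association scheme whose intersection numbers coincide with those of the flag scheme of a generalized quadrangle of order (s,t) (s,t ≥ 1). Let C_1 be a point-clique and C_2 a line-clique which are incident, with common element z. Then (x,y) ∈ R'_4 for every x ∈ C_1 \ {z} and every y ∈ C_2 \ {z}. Conversely, if (x,y) ∈ R'_4, then the point-clique C_1(x) and the line-clique C_2(y) are incident. -/
/-- A generalized quadrangle has a flag. -/
theorem IsGQ.nonempty_flag {s t : ℕ} {P L : Type*} {I : P → L → Prop} (hGQ : IsGQ s t P L I) :
    Nonempty (GQFlag I) := by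
  obtain ⟨p⟩ := hGQ.nonemptyP
  have hpos : 0 < Nat.card {l : L // I p l} := by
    rw [hGQ.lines_through p]
    exact Nat.succ_pos t
  obtain ⟨l, hl⟩ := (Nat.card_pos_iff.mp hpos).1
  exact ⟨⟨(p, l), hl⟩⟩

/-- The flag set of a finite generalized quadrangle is finite. -/
theorem IsGQ.finite_flag_s10 {s t : ℕ} {P L : Type*} {I : P → L → Prop} (hGQ : IsGQ s t P L I) :
    Finite (GQFlag I) := by
  have := hGQ.finP
  have := hGQ.finL
  unfold GQFlag
  infer_instance

/-- On flags, the composite of `R_1` and `R_2` is `R_4`. -/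
theorem exists_rrel_one_two_iff {P L : Type*} {I : P → L → Prop} {u v : GQFlag I} :
    (∃ w, Rrel I 1 u w ∧ Rrel I 2 w v) ↔ Rrel I 4 u v := by
  constructor
  · rintro ⟨w, ⟨hp, hl⟩, hm, hq⟩
    refine ⟨fun h => hq (hp.symm.trans h), fun h => hl (h.trans hm.symm), ?_⟩
    rw [hp, ← hm]
    exact w.2
  · rintro ⟨hp, hl, hI⟩
    exact ⟨⟨(u.1.1, v.1.2), hI⟩, ⟨rfl, hl⟩, rfl, hp⟩

/-- The relation `R_4` on the flags of a generalized quadrangle is disjoint from the others. -/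
theorem IsGQ.eq_four_of_rrel {s t : ℕ} {P L : Type*} {I : P → L → Prop} (hGQ : IsGQ s t P L I)
    {k : ℕ} {u v : GQFlag I} (h4 : Rrel I 4 u v) (hk : Rrel I k u v) : k = 4 := by
  obtain ⟨hp, hl, hI⟩ := h4
  match k, hk with
  | 0, h => exact absurd (congrArg (fun f : GQFlag I => f.1.1) h) hp
  | 1, h => exact absurd h.1 hp
  | 2, h => exact absurd h.1 hl
  | 3, h => exact absurd (hGQ.unique_line _ _ hp _ _ u.2 h.2.2 hI v.2) hl
  | 4, _ => rfl
  | 5, ⟨_, N, hN, hN', _, hne⟩ => exact absurd (hGQ.unique_line _ _ hp _ _ hN hN' hI v.2) hne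
  | 6, ⟨_, r, hr, hr', hne, _⟩ => exact absurd (hGQ.unique_point _ _ hl _ _ hr hr' u.2 hI) hne
  | 7, h => exact absurd ⟨u.2, hI⟩ (h.1 _)
  | _ + 8, h => exact h.elim

/-- Subtypes of finite types with the same cardinality are inhabited simultaneously. -/
theorem exists_iff_exists_of_card_eq {α β : Type*} [Finite α] [Finite β] {p : α → Prop}
    {q : β → Prop} (h : Nat.card {a // p a} = Nat.card {b // q b}) :
    (∃ a, p a) ↔ ∃ b, q b := by
  rw [← nonempty_subtype, ← nonempty_subtype, ← Finite.card_pos_iff, ← Finite.card_pos_iff, h]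

/-- in an association scheme with the intersection numbers of the
flag scheme of a GQ of order `(s,t)`, if a point-clique and a line-clique are
incident with common element `z`, then all pairs of their other elements lie in
`R'_4`; conversely `R'_4` forces incidence of the corresponding cliques. -/
theorem stmt_10 {s t : ℕ} (hs : 1 ≤ s) (ht : 1 ≤ t)
    {Ω' : Type*} (R' : ℕ → Ω' → Ω' → Prop)
    (hfin : Finite Ω')
    (hpart : ∀ x y : Ω', ∃! i : ℕ, i < 8 ∧ R' i x y)
    (hdiag : ∀ x y : Ω', R' 0 x y ↔ x = y)
    (htr : ∀ x y : Ω', R' 4 x y ↔ R' 3 y x)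
    (hsymm : ∀ i : ℕ, i < 8 → i ≠ 3 → i ≠ 4 → ∀ x y : Ω', R' i x y ↔ R' i y x)
    {P L : Type*} (I : P → L → Prop) (hGQ : IsGQ s t P L I)
    (hinter : ∀ i j k : ℕ, i < 8 → j < 8 → k < 8 →
      ∀ x y : Ω', R' k x y → ∀ u v : GQFlag I, Rrel I k u v →
        Nat.card {z : Ω' // R' i x z ∧ R' j z y} =
        Nat.card {w : GQFlag I // Rrel I i u w ∧ Rrel I j w v}) :
    (∀ z : Ω', ∀ x ∈ PC R' z, x ≠ z → ∀ y ∈ LC R' z, y ≠ z → R' 4 x y) ∧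
    (∀ x y : Ω', R' 4 x y → (PC R' x ∩ LC R' y).Nonempty) := by
  have := hGQ.finite_flag_s10
  obtain ⟨f⟩ := hGQ.nonempty_flag
  have htranspose : ∀ k < 8, ∃ k' < 8, ∀ x y : Ω', R' k x y → R' k' y x := by
    intro k hk
    by_cases h3 : k = 3
    · subst h3
      exact ⟨4, by norm_num, fun x y h => (htr y x).mpr h⟩
    by_cases h4 : k = 4
    · subst h4
      exact ⟨3, by norm_num, fun x y h => (htr x y).mp h⟩
    exact ⟨k, hk, fun x y h => (hsymm k hk h3 h4 x y).mp h⟩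
  -- A relation that occurs in `Ω'` has positive valency, so it also occurs among the flags.
  have hoccurs : ∀ k < 8, ∀ x y : Ω', R' k x y → ∃ v, Rrel I k f v := by
    intro k hk x y hxy
    obtain ⟨k', hk', htk⟩ := htranspose k hk
    obtain ⟨v, hv, -⟩ := (exists_iff_exists_of_card_eq
      (hinter k k' 0 hk hk' (by norm_num) x x ((hdiag x x).mpr rfl) f f rfl)).mp
      ⟨y, hxy, htk x y hxy⟩
    exact ⟨v, hv⟩
  have hcomp : ∀ k < 8, ∀ x y : Ω', R' k x y → ((∃ z, R' 1 x z ∧ R' 2 z y) ↔ k = 4) := by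
    intro k hk x y hxy
    obtain ⟨v, hv⟩ := hoccurs k hk x y hxy
    rw [exists_iff_exists_of_card_eq
      (hinter 1 2 k (by norm_num) (by norm_num) hk x y hxy f v hv), exists_rrel_one_two_iff]
    exact ⟨fun h => hGQ.eq_four_of_rrel h hv, fun h => h ▸ hv⟩
  have hsymm1 := hsymm 1 (by norm_num) (by norm_num) (by norm_num)
  have hsymm2 := hsymm 2 (by norm_num) (by norm_num) (by norm_num)
  constructor
  · intro z x hx hxz y hy hyz
    have hzx : R' 1 z x := hx.resolve_left hxz
    have hzy : R' 2 z y := hy.resolve_left hyz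
    obtain ⟨k, ⟨hk, hxy⟩, -⟩ := hpart x y
    exact (hcomp k hk x y hxy).mp ⟨z, (hsymm1 z x).mp hzx, hzy⟩ ▸ hxy
  · intro x y hxy
    obtain ⟨z, hxz, hzy⟩ := (hcomp 4 (by norm_num) x y hxy).mpr rfl
    exact ⟨z, Or.inr hxz, Or.inr ((hsymm2 z y).mp hzy)⟩
end

section
/- Let Ω' with relations R'_0,...,R'_7 be an association scheme whose intersection numbers coincide with those of the flag scheme of a generalized quadrangle of order (s,t) (s,t ≥ 1). Let C_1 be a point-clique and C_2 a line-clique which are not incident. Then there exists at most one pair (x,y) ∈ C_1 × C_2 with (x,y) ∈ R'_3. -/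
section FlagRelations

variable {s t : ℕ} {P L : Type*} {I : P → L → Prop}

/-- A generalized quadrangle contains no triangles. -/
theorem IsGQ.no_triangle_s11 (h : IsGQ s t P L I) {p q r : P} {l m n : L} (hpl : ¬ I p l)
    (hpm : I p m) (hqm : I q m) (hql : I q l) (hpn : I p n) (hrn : I r n) (hrl : I r l) :
    q = r ∧ m = n := by
  have := (h.gq3 p l hpl).unique (y₁ := (q, m)) (y₂ := (r, n)) ⟨hpm, hqm, hql⟩ ⟨hpn, hrn, hrl⟩
  simpa using this

theorem IsGQ.exists_ne_line (h : IsGQ s t P L I) (ht : 1 ≤ t) (p : P) (l : L) :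
    ∃ m, I p m ∧ m ≠ l := by
  have hc := h.lines_through p
  have := h.finL
  have : Nontrivial {l : L // I p l} := Finite.one_lt_card_iff_nontrivial.mp (by omega)
  obtain ⟨⟨m, hm⟩, ⟨n, hn⟩, hmn⟩ := exists_pair_ne {l : L // I p l}
  have hmn : m ≠ n := fun e => hmn (Subtype.ext e)
  by_cases hml : m = l
  · exact ⟨n, hn, fun e => hmn (hml.trans e.symm)⟩
  · exact ⟨m, hm, hml⟩

theorem IsGQ.exists_ne_point (h : IsGQ s t P L I) (hs : 1 ≤ s) (l : L) (p : P) :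
    ∃ q, I q l ∧ q ≠ p := by
  have hc := h.points_on l
  have := h.finP
  have : Nontrivial {p : P // I p l} := Finite.one_lt_card_iff_nontrivial.mp (by omega)
  obtain ⟨⟨m, hm⟩, ⟨n, hn⟩, hmn⟩ := exists_pair_ne {p : P // I p l}
  have hmn : m ≠ n := fun e => hmn (Subtype.ext e)
  by_cases hml : m = p
  · exact ⟨n, hn, fun e => hmn (hml.trans e.symm)⟩
  · exact ⟨m, hm, hml⟩

/-- Flags `(p, l)`, `(q, l)`, `(q, m)` with `p ≠ q` and `l ≠ m`, realising `R_1`, `R_2`, `R_3`. -/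
theorem IsGQ.exists_path (h : IsGQ s t P L I) (hs : 1 ≤ s) (ht : 1 ≤ t) :
    ∃ u w v : GQFlag I, Rrel I 2 u w ∧ Rrel I 1 w v ∧ Rrel I 3 u v := by
  obtain ⟨l⟩ := h.nonemptyL
  obtain ⟨p₀⟩ := h.nonemptyP
  obtain ⟨p, hp, -⟩ := h.exists_ne_point hs l p₀
  obtain ⟨q, hq, hqp⟩ := h.exists_ne_point hs l p
  obtain ⟨m, hm, hml⟩ := h.exists_ne_line ht q l
  exact ⟨⟨(p, l), hp⟩, ⟨(q, l), hq⟩, ⟨(q, m), hm⟩, ⟨rfl, hqp.symm⟩, ⟨rfl, hml.symm⟩,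
    hqp.symm, hml.symm, hq⟩

theorem IsGQ.eq_one_of_same_point (h : IsGQ s t P L I) {k : ℕ} (hk : k < 8) {u v w : GQFlag I}
    (huv : Rrel I 1 u v) (huw : Rrel I 1 u w) (hwv : Rrel I k w v) : k = 0 ∨ k = 1 := by
  obtain ⟨⟨p, l⟩, hu⟩ := u
  obtain ⟨⟨q, m⟩, hv⟩ := v
  obtain ⟨⟨r, n⟩, hw⟩ := w
  obtain ⟨h1, -⟩ := huv
  obtain ⟨h2, -⟩ := huw
  dsimp only at h1 h2 hu hv hw
  subst h1 h2
  interval_cases k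
  · exact .inl rfl
  · exact .inr rfl
  · exact absurd rfl hwv.2
  · exact absurd rfl hwv.1
  · exact absurd rfl hwv.1
  · exact absurd rfl hwv.1
  · obtain ⟨hnm, r, hr1, hr2, hr3, -⟩ := hwv
    exact absurd (h.unique_point _ _ hnm _ _ hr1 hr2 hw hv) hr3
  · exact absurd ⟨hw, hv⟩ (hwv.1 p)

theorem IsGQ.eq_two_of_same_line (h : IsGQ s t P L I) {k : ℕ} (hk : k < 8) {u v w : GQFlag I}
    (huv : Rrel I 2 u v) (huw : Rrel I 2 u w) (hwv : Rrel I k w v) : k = 0 ∨ k = 2 := by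
  obtain ⟨⟨p, l⟩, hu⟩ := u
  obtain ⟨⟨q, m⟩, hv⟩ := v
  obtain ⟨⟨r, n⟩, hw⟩ := w
  obtain ⟨h1, -⟩ := huv
  obtain ⟨h2, -⟩ := huw
  dsimp only at h1 h2 hu hv hw
  subst h1 h2
  interval_cases k
  · exact .inl rfl
  · exact absurd rfl hwv.2
  · exact .inr rfl
  · exact absurd rfl hwv.2.1
  · exact absurd rfl hwv.2.1
  · obtain ⟨hrq, n, hn1, hn2, hn3, -⟩ := hwv
    exact absurd (h.unique_line _ _ hrq _ _ hn1 hn2 hw hv) hn3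
  · exact absurd rfl hwv.1
  · exact absurd ⟨hw, hw⟩ (hwv.1 r)

/-- `R_1 ∘ R_3` is contained in `R_5`. -/
theorem IsGQ.eq_five (h : IsGQ s t P L I) {k : ℕ} (hk : k < 8) {u v w : GQFlag I}
    (huv : Rrel I 3 u v) (huw : Rrel I 1 u w) (hwv : Rrel I k w v) : k = 5 := by
  obtain ⟨⟨p, l⟩, hu⟩ := u
  obtain ⟨⟨q, m⟩, hv⟩ := v
  obtain ⟨⟨r, n⟩, hw⟩ := w
  obtain ⟨hpq, hlm, hql⟩ := huv
  obtain ⟨h2, hln⟩ := huw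
  dsimp only at h2 hu hv hw hpq hlm hql hln
  subst h2
  have hpm : ¬ I p m := fun hpm => hlm (h.unique_line _ _ hpq _ _ hu hql hpm hv)
  interval_cases k
  · exact absurd (congrArg (fun x => x.1.1) hwv) hpq
  · exact absurd hwv.1 hpq
  · have hnm : n = m := hwv.1
    exact absurd (hnm ▸ hw) hpm
  · exact absurd (h.unique_line _ _ hpq _ _ hu hql hw hwv.2.2) hln
  · exact absurd hwv.2.2 hpm
  · rfl
  · obtain ⟨-, r, hr1, hr2, -, -⟩ := hwv
    exact absurd (h.no_triangle_s11 hpm hu hql hv hw hr1 hr2).2 hln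
  · exact absurd ⟨hpq, l, hu, hql⟩ hwv.2

/-- `R_3 ∘ R_2` is disjoint from `R_5`. -/
theorem IsGQ.not_rrel_five (h : IsGQ s t P L I) {u v w : GQFlag I}
    (huv : Rrel I 3 u v) (hwv : Rrel I 2 w v) : ¬ Rrel I 5 u w := by
  obtain ⟨⟨p, l⟩, hu⟩ := u
  obtain ⟨⟨q, m⟩, hv⟩ := v
  obtain ⟨⟨r, n⟩, hw⟩ := w
  obtain ⟨hpq, hlm, hql⟩ := huv
  obtain ⟨h2, -⟩ := hwv
  dsimp only at h2 hu hv hw hpq hlm hql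
  subst h2
  rintro ⟨-, o, ho1, ho2, ho3, -⟩
  have hpm : ¬ I p n := fun hpm => hlm (h.unique_line _ _ hpq _ _ hu hql hpm hv)
  exact ho3 (h.no_triangle_s11 hpm hu hql hv ho1 ho2 hw).2.symm

/-- `R_3 ∘ R_2` is disjoint from `R_3`. -/
theorem IsGQ.not_rrel_three (h : IsGQ s t P L I) {u v w : GQFlag I}
    (huv : Rrel I 3 u v) (hwv : Rrel I 2 w v) : ¬ Rrel I 3 u w := by
  obtain ⟨⟨p, l⟩, hu⟩ := u
  obtain ⟨⟨q, m⟩, hv⟩ := v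
  obtain ⟨⟨r, n⟩, hw⟩ := w
  obtain ⟨-, hlm, hql⟩ := huv
  obtain ⟨h2, hrq⟩ := hwv
  dsimp only at h2 hu hv hw hrq hlm hql
  subst h2
  rintro ⟨-, -, hrl⟩
  exact hlm (h.unique_line _ _ hrq _ _ hrl hql hw hv)

end FlagRelations

/-- in an association scheme with the intersection numbers of the
flag scheme of a GQ of order `(s,t)`, a non-incident point-clique/line-clique
pair carries at most one pair of elements in relation `R'_3`. -/
theorem stmt_11 {s t : ℕ} (hs : 1 ≤ s) (ht : 1 ≤ t)
    {Ω' : Type*} (R' : ℕ → Ω' → Ω' → Prop)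
    (hfin : Finite Ω')
    (hpart : ∀ x y : Ω', ∃! i : ℕ, i < 8 ∧ R' i x y)
    (hdiag : ∀ x y : Ω', R' 0 x y ↔ x = y)
    (htr : ∀ x y : Ω', R' 4 x y ↔ R' 3 y x)
    (hsymm : ∀ i : ℕ, i < 8 → i ≠ 3 → i ≠ 4 → ∀ x y : Ω', R' i x y ↔ R' i y x)
    {P L : Type*} (I : P → L → Prop) (hGQ : IsGQ s t P L I)
    (hinter : ∀ i j k : ℕ, i < 8 → j < 8 → k < 8 →
      ∀ x y : Ω', R' k x y → ∀ u v : GQFlag I, Rrel I k u v →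
        Nat.card {z : Ω' // R' i x z ∧ R' j z y} =
        Nat.card {w : GQFlag I // Rrel I i u w ∧ Rrel I j w v}) :
    ∀ a b : Ω', PC R' a ∩ LC R' b = ∅ →
      ∀ x ∈ PC R' a, ∀ y ∈ LC R' b, ∀ x' ∈ PC R' a, ∀ y' ∈ LC R' b,
        R' 3 x y → R' 3 x' y' → x = x' ∧ y = y' := by
  intro a b _ x hx y hy x' hx' y' hy' hxy hxy'
  have transfer : ∀ {i j k : ℕ}, i < 8 → j < 8 → k < 8 → ∀ {x y z : Ω'}, R' k x y → R' i x z →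
      R' j z y → ∀ {u v : GQFlag I}, Rrel I k u v → ∃ w, Rrel I i u w ∧ Rrel I j w v := by
    intro i j k hi hj hk x y z hxy hxz hzy u v huv
    have hcard := hinter i j k hi hj hk x y hxy u v huv
    have : Nonempty {z : Ω' // R' i x z ∧ R' j z y} := ⟨⟨z, hxz, hzy⟩⟩
    have hpos : 0 < Nat.card {z : Ω' // R' i x z ∧ R' j z y} := Nat.card_pos
    rw [hcard] at hpos
    obtain ⟨⟨w, hw⟩⟩ := (Nat.card_pos_iff.mp hpos).1
    exact ⟨w, hw⟩
  have symm₁ : ∀ {x y}, R' 1 x y → R' 1 y x := fun h =>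
    (hsymm 1 (by omega) (by omega) (by omega) _ _).mp h
  have symm₂ : ∀ {x y}, R' 2 x y → R' 2 y x := fun h =>
    (hsymm 2 (by omega) (by omega) (by omega) _ _).mp h
  obtain ⟨u₃, u₁, v, h₂, h₁, h₃⟩ := hGQ.exists_path hs ht
  have same_point : x = x' ∨ R' 1 x x' := by
    rcases hx with rfl | hx <;> rcases hx' with rfl | hx'
    · exact .inl rfl
    · exact .inr hx'
    · exact .inr (symm₁ hx)
    · obtain ⟨k, ⟨hk, hkx⟩, -⟩ := hpart x x'
      obtain ⟨w, hw, hwv⟩ := transfer (by omega) hk (by omega) hx' hx hkx h₁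
      rcases hGQ.eq_one_of_same_point hk h₁ hw hwv with rfl | rfl
      · exact .inl ((hdiag _ _).mp hkx)
      · exact .inr hkx
  have same_line : y = y' ∨ R' 2 y y' := by
    rcases hy with rfl | hy <;> rcases hy' with rfl | hy'
    · exact .inl rfl
    · exact .inr hy'
    · exact .inr (symm₂ hy)
    · obtain ⟨k, ⟨hk, hky⟩, -⟩ := hpart y y'
      obtain ⟨w, hw, hwv⟩ := transfer (by omega) hk (by omega) hy' hy hky h₂
      rcases hGQ.eq_two_of_same_line hk h₂ hw hwv with rfl | rfl
      · exact .inl ((hdiag _ _).mp hky)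
      · exact .inr hky
  obtain ⟨k, ⟨hk, hkxy⟩, -⟩ := hpart x y'
  rcases same_point with rfl | hxx
  · rcases same_line with rfl | hyy
    · exact ⟨rfl, rfl⟩
    · obtain ⟨w, hw, hwv⟩ := transfer (by omega) (by omega) (by omega) hxy hxy' (symm₂ hyy) h₃
      exact absurd hw (hGQ.not_rrel_three h₃ hwv)
  · obtain ⟨w, hw, hwv⟩ := transfer (by omega) hk (by omega) hxy' (symm₁ hxx) hkxy h₃
    obtain rfl := hGQ.eq_five hk h₃ hw hwv
    rcases same_line with rfl | hyy
    · obtain ⟨i, -, hi⟩ := hpart x y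
      have := hi 5 ⟨by omega, hkxy⟩
      have := hi 3 ⟨by omega, hxy⟩
      omega
    · obtain ⟨w, hw, hwv⟩ := transfer (by omega) (by omega) (by omega) hxy hkxy (symm₂ hyy) h₃
      exact absurd hw (hGQ.not_rrel_five h₃ hwv)
end

section
/- Let Ω' with relations S'_0,...,S'_4 be an association scheme whose intersection numbers coincide with those of the 4-class fusion scheme of the flag scheme of a generalized quadrangle of order (s,s), s ≥ 1. Let C_1 and C_2 be the two (maximal S'_1-)cliques containing a vertex x ∈ Ω'. Then for every u ∈ C_1 \ {x} and every v ∈ C_2 \ {x}, one has (u,v) ∈ S'_2. -/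
section FlagGeometry

variable {P L : Type*} {I : P → L → Prop} {s t : ℕ}

theorem IsGQ.exists_line_ne (h : IsGQ s t P L I) (ht : 1 ≤ t) {p : P} {N : L} (hN : I p N) :
    ∃ M, M ≠ N ∧ I p M := by
  have := h.finL
  have hcard : 1 < Nat.card {l : L // I p l} := by rw [h.lines_through]; omega
  have := Finite.one_lt_card_iff_nontrivial.1 hcard
  obtain ⟨⟨M, hM⟩, hne⟩ := exists_ne (⟨N, hN⟩ : {l : L // I p l})
  exact ⟨M, fun e => hne (Subtype.ext e), hM⟩

theorem IsGQ.exists_point_ne (h : IsGQ s t P L I) (hs : 1 ≤ s) {p : P} {N : L} (hN : I p N) :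
    ∃ q, q ≠ p ∧ I q N := by
  have := h.finP
  have hcard : 1 < Nat.card {q : P // I q N} := by rw [h.points_on]; omega
  have := Finite.one_lt_card_iff_nontrivial.1 hcard
  obtain ⟨⟨q, hq⟩, hne⟩ := exists_ne (⟨p, hN⟩ : {q : P // I q N})
  exact ⟨q, fun e => hne (Subtype.ext e), hq⟩

theorem IsGQ.exists_flag (h : IsGQ s t P L I) : ∃ p N, I p N := by
  obtain ⟨l⟩ := h.nonemptyL
  have hcard : Nat.card {q : P // I q l} ≠ 0 := by rw [h.points_on]; omega
  obtain ⟨⟨⟨p, hp⟩⟩, -⟩ := Nat.card_ne_zero.1 hcard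
  exact ⟨p, l, hp⟩

/-- Some `S_2`-related pair of flags has at most one common `S_1`-neighbour. -/
theorem IsGQ.exists_srel_two (h : IsGQ s t P L I) (hs : 1 ≤ s) (ht : 1 ≤ t) :
    ∃ u v : GQFlag I, Srel I 2 u v ∧
      Nat.card {w : GQFlag I // Srel I 1 u w ∧ Srel I 1 w v} ≤ 1 := by
  obtain ⟨p, N, hp⟩ := h.exists_flag
  obtain ⟨q, hqp, hq⟩ := h.exists_point_ne hs hp
  obtain ⟨M, hMN, hM⟩ := h.exists_line_ne ht hq
  refine ⟨⟨(p, N), hp⟩, ⟨(q, M), hM⟩, Or.inl ⟨hqp.symm, hMN.symm, hq⟩, ?_⟩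
  have key : ∀ w : GQFlag I, Srel I 1 ⟨(p, N), hp⟩ w ∧ Srel I 1 w ⟨(q, M), hM⟩ →
      w = ⟨(q, N), hq⟩ := by
    rintro ⟨⟨r, K⟩, hr⟩ ⟨h₁, h₂⟩
    simp only [Srel, Rrel] at h₁ h₂ hr
    rcases h₁ with ⟨rfl, -⟩ | ⟨rfl, -⟩ <;> rcases h₂ with ⟨rfl, -⟩ | ⟨rfl, -⟩
    · exact absurd rfl hqp
    · exact absurd (h.unique_line p q hqp.symm _ _ hr hM hp hq) hMN
    · rfl
    · exact absurd rfl hMN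
  have : Subsingleton {w : GQFlag I // Srel I 1 ⟨(p, N), hp⟩ w ∧ Srel I 1 w ⟨(q, M), hM⟩} :=
    ⟨fun a b => Subtype.ext ((key _ a.2).trans (key _ b.2).symm)⟩
  exact Finite.card_le_one_iff_subsingleton.2 this

/-- Some `S_3`-related pair of flags has no common `S_1`-neighbour. -/
theorem IsGQ.exists_srel_three (h : IsGQ s t P L I) (hs : 1 ≤ s) (ht : 1 ≤ t) :
    ∃ u v : GQFlag I, Srel I 3 u v ∧
      Nat.card {w : GQFlag I // Srel I 1 u w ∧ Srel I 1 w v} = 0 := by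
  obtain ⟨p, N, hp⟩ := h.exists_flag
  obtain ⟨q, hqp, hq⟩ := h.exists_point_ne hs hp
  obtain ⟨M, hMN, hM⟩ := h.exists_line_ne ht hq
  obtain ⟨K, hKN, hK⟩ := h.exists_line_ne ht hp
  refine ⟨⟨(p, K), hK⟩, ⟨(q, M), hM⟩, Or.inl ⟨hqp.symm, N, hp, hq, hKN.symm, hMN.symm⟩, ?_⟩
  refine Nat.card_eq_zero.2 (Or.inl ⟨?_⟩)
  rintro ⟨⟨⟨r, J⟩, hr⟩, h₁, h₂⟩
  simp only [Srel, Rrel] at h₁ h₂ hr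
  rcases h₁ with ⟨rfl, -⟩ | ⟨rfl, -⟩ <;> rcases h₂ with ⟨rfl, -⟩ | ⟨rfl, -⟩
  · exact hqp rfl
  · exact hMN (h.unique_line p q hqp.symm _ _ hr hM hp hq)
  · exact hKN (h.unique_line p _ hqp.symm _ _ hK hr hp hq)
  · exact hMN (h.unique_line p q hqp.symm _ _ hK hM hp hq)

/-- Some `S_4`-related pair of flags has no common `S_1`-neighbour. -/
theorem IsGQ.exists_srel_four (h : IsGQ s t P L I) (hs : 1 ≤ s) (ht : 1 ≤ t) :
    ∃ u v : GQFlag I, Srel I 4 u v ∧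
      Nat.card {w : GQFlag I // Srel I 1 u w ∧ Srel I 1 w v} = 0 := by
  obtain ⟨p, K, hp⟩ := h.exists_flag
  obtain ⟨r, hrp, hr⟩ := h.exists_point_ne hs hp
  obtain ⟨N, hNK, hrN⟩ := h.exists_line_ne ht hr
  obtain ⟨q, hqr, hq⟩ := h.exists_point_ne hs hrN
  obtain ⟨M, hMN, hM⟩ := h.exists_line_ne ht hq
  have hpN : ¬ I p N := fun e => hNK (h.unique_line p r hrp.symm _ _ e hrN hp hr)
  have hqK : ¬ I q K := fun e => hNK (h.unique_line q r hqr _ _ hq hrN e hr)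
  have hdisj : ∀ a, ¬ (I a K ∧ I a M) := fun a ha => hMN <| congrArg Prod.snd <|
    (h.gq3 q K hqK).unique (y₁ := (a, M)) (y₂ := (r, N)) ⟨hM, ha.2, ha.1⟩ ⟨hq, hrN, hr⟩
  have hcol : ¬ Collin I p q := fun ⟨_, J, hpJ, hqJ⟩ => hqr <| congrArg Prod.fst <|
    (h.gq3 p N hpN).unique (y₁ := (q, J)) (y₂ := (r, K)) ⟨hpJ, hqJ, hq⟩ ⟨hp, hr, hrN⟩
  refine ⟨⟨(p, K), hp⟩, ⟨(q, M), hM⟩, ⟨hdisj, hcol⟩, ?_⟩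
  refine Nat.card_eq_zero.2 (Or.inl ⟨?_⟩)
  rintro ⟨⟨⟨a, J⟩, ha⟩, h₁, h₂⟩
  simp only [Srel, Rrel] at h₁ h₂ ha
  rcases h₁ with ⟨rfl, -⟩ | ⟨rfl, -⟩ <;> rcases h₂ with ⟨rfl, -⟩ | ⟨rfl, -⟩
  · exact hdisj _ ⟨hp, hM⟩
  · exact hdisj _ ⟨hp, ha⟩
  · exact hdisj _ ⟨ha, hM⟩
  · exact hdisj _ ⟨hp, hp⟩

end FlagGeometry

/-- If adjacency is transitive on the neighbourhood of `x`, then distinct maximal cliques through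
`x` meet only in `x` and have no edges between them outside `x`. -/
theorem IsMaxClique.not_adj {α : Type*} {rel : α → α → Prop} {C₁ C₂ : Set α}
    (hC₁ : IsMaxClique rel C₁) (hC₂ : IsMaxClique rel C₂) {x : α}
    (hsymm : ∀ a b, rel a b → rel b a)
    (htrans : ∀ a b c, rel x a → rel x b → rel x c → rel a b → rel b c → a = c ∨ rel a c)
    (hx₁ : x ∈ C₁) (hx₂ : x ∈ C₂) (hne : C₁ ≠ C₂)
    {u v : α} (hu : u ∈ C₁) (hux : u ≠ x) (hv : v ∈ C₂) (hvx : v ≠ x) :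
    ¬ (u = v ∨ rel u v) := by
  intro huv
  have adj₁ : ∀ a ∈ C₁, a ≠ x → rel x a := fun a ha hax => hC₁.1 x hx₁ a ha hax.symm
  have adj₂ : ∀ a ∈ C₂, a ≠ x → rel x a := fun a ha hax => hC₂.1 x hx₂ a ha hax.symm
  have htrans' : ∀ a b c, rel x a → rel x b → rel x c → (a = b ∨ rel a b) → (b = c ∨ rel b c) →
      a = c ∨ rel a c := by
    rintro a b c ha hb hc (rfl | hab) (rfl | hbc)
    · exact Or.inl rfl
    · exact Or.inr hbc
    · exact Or.inr hab
    · exact htrans a b c ha hb hc hab hbc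
  have cross : ∀ a ∈ C₁, ∀ b ∈ C₂, a ≠ b → rel a b := by
    intro a ha b hb hab
    by_cases hax : a = x
    · subst hax; exact hC₂.1 a hx₂ b hb hab
    by_cases hbx : b = x
    · subst hbx; exact hC₁.1 a ha b hx₁ hab
    have hau : a = u ∨ rel a u := or_iff_not_imp_left.2 (hC₁.1 a ha u hu)
    have hvb : v = b ∨ rel v b := or_iff_not_imp_left.2 (hC₂.1 v hv b hb)
    have hav := htrans' a u v (adj₁ a ha hax) (adj₁ u hu hux) (adj₂ v hv hvx) hau huv
    exact (htrans' a v b (adj₁ a ha hax) (adj₂ v hv hvx) (adj₂ b hb hbx) hav hvb).resolve_left hab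
  have hclique : ∀ a ∈ C₁ ∪ C₂, ∀ b ∈ C₁ ∪ C₂, a ≠ b → rel a b := by
    rintro a (ha | ha) b (hb | hb) hab
    · exact hC₁.1 a ha b hb hab
    · exact cross a ha b hb hab
    · exact hsymm _ _ (cross b hb a ha hab.symm)
    · exact hC₂.1 a ha b hb hab
  exact hne ((hC₁.2 _ Set.subset_union_left hclique).symm.trans
    (hC₂.2 _ Set.subset_union_right hclique))

/-- if `C₁` and `C₂` are the two maximal `S'_1`-cliques through a
vertex `x`, then every `u ∈ C₁ \ {x}` and `v ∈ C₂ \ {x}` satisfy `(u,v) ∈ S'_2`. -/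
theorem stmt_17 {s : ℕ} (hs : 1 ≤ s)
    {Ω' : Type*} (S' : ℕ → Ω' → Ω' → Prop)
    (hfin : Finite Ω')
    (hpart : ∀ x y : Ω', ∃! l : ℕ, l < 5 ∧ S' l x y)
    (hdiag : ∀ x y : Ω', S' 0 x y ↔ x = y)
    (hsymm : ∀ l : ℕ, l < 5 → ∀ x y : Ω', S' l x y ↔ S' l y x)
    {P L : Type*} (I : P → L → Prop) (hGQ : IsGQ s s P L I)
    (hinter : ∀ i j k : ℕ, i < 5 → j < 5 → k < 5 →
      ∀ x y : Ω', S' k x y → ∀ u v : GQFlag I, Srel I k u v →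
        Nat.card {z : Ω' // S' i x z ∧ S' j z y} =
        Nat.card {w : GQFlag I // Srel I i u w ∧ Srel I j w v})
    (x : Ω') (C₁ C₂ : Set Ω')
    (hC₁ : IsMaxClique (S' 1) C₁) (hC₂ : IsMaxClique (S' 1) C₂)
    (hx₁ : x ∈ C₁) (hx₂ : x ∈ C₂) (hne : C₁ ≠ C₂) :
    ∀ u ∈ C₁, u ≠ x → ∀ v ∈ C₂, v ≠ x → S' 2 u v := by
  have symm₁ : ∀ a b, S' 1 a b → S' 1 b a := fun a b => (hsymm 1 (by omega) a b).1
  have path : ∀ a c, S' 1 x a → S' 1 x c → a = c ∨ S' 1 a c ∨ S' 2 a c := by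
    intro a c ha hc
    have hpos : Nat.card {z : Ω' // S' 1 a z ∧ S' 1 z c} ≠ 0 :=
      Nat.card_ne_zero.2 ⟨⟨x, symm₁ _ _ ha, hc⟩, inferInstance⟩
    obtain ⟨k, ⟨hk, hac⟩, -⟩ := hpart a c
    interval_cases k
    · exact Or.inl ((hdiag a c).1 hac)
    · exact Or.inr (Or.inl hac)
    · exact Or.inr (Or.inr hac)
    · obtain ⟨f, g, hfg, h0⟩ := hGQ.exists_srel_three hs hs
      exact absurd ((hinter 1 1 3 (by omega) (by omega) (by omega) a c hac f g hfg).trans h0) hpos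
    · obtain ⟨f, g, hfg, h0⟩ := hGQ.exists_srel_four hs hs
      exact absurd ((hinter 1 1 4 (by omega) (by omega) (by omega) a c hac f g hfg).trans h0) hpos
  have irrefl₁ : ∀ a, ¬ S' 1 a a := fun a h => by
    have := (hpart a a).unique ⟨by omega, h⟩ ⟨by omega, (hdiag a a).2 rfl⟩
    omega
  have htrans : ∀ a b c, S' 1 x a → S' 1 x b → S' 1 x c → S' 1 a b → S' 1 b c →
      a = c ∨ S' 1 a c := by
    intro a b c ha hb hc hab hbc
    rcases path a c ha hc with h | h | h
    · exact Or.inl h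
    · exact Or.inr h
    · obtain ⟨f, g, hfg, h1⟩ := hGQ.exists_srel_two hs hs
      rw [← hinter 1 1 2 (by omega) (by omega) (by omega) a c h f g hfg,
        Finite.card_le_one_iff_subsingleton] at h1
      have hxb : x = b := congrArg Subtype.val
        (h1.elim ⟨x, symm₁ _ _ ha, hc⟩ ⟨b, hab, hbc⟩)
      exact absurd (hxb ▸ hb) (irrefl₁ x)
  intro u hu hux v hv hvx
  have hnot := hC₁.not_adj hC₂ symm₁ htrans hx₁ hx₂ hne hu hux hv hvx
  rcases path u v (hC₁.1 x hx₁ u hu hux.symm) (hC₂.1 x hx₂ v hv hvx.symm) with h | h | h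
  · exact absurd (Or.inl h) hnot
  · exact absurd (Or.inr h) hnot
  · exact h
end
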